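/- Let f : ℝⁿ → ℝ be twice continuously differentiable with μI ⪯ ∇²f(x) ⪯ LI for all x (0 < μ ≤ L, κ = L/μ) and M-strongly self-concordant. Consider the SR1_CS iteration: G₀ = L·I, r_{−1} = 0, and for k ≥ 0: x_{k+1} = x_k − G_k⁻¹∇f(x_k), u_k = x_{k+1} − x_k, r_k = ‖u_k‖_{x_k}, G̃_k = (1 + Mr_{k−1}/2)(1 + Mr_k/2)G_k, J_k = ∫₀¹ ∇²f(x_k + t u_k) dt, G_{k+1} = SR1(J_k, G̃_k, u_k). If M·λ_f(x₀) ≤ ln(3/2)/(4κ), then for all k ≥ 1: λ_f(x_k) ≤ (e^{2n·ln(eκ)/k} − 1)^{k/2} · √(3κ) · λ_f(x₀), where λ_f(x) = √(∇f(x)ᵀ[∇²f(x)]⁻¹∇f(x)). -/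

import Mathlib

open Matrix

/-- The SR1 quasi-Newton update of `G` with respect to target `A` along direction `u`. -/
noncomputable def SR1 {n : ℕ} (A G : Matrix (Fin n) (Fin n) ℝ) (u : Fin n → ℝ) :
    Matrix (Fin n) (Fin n) ℝ :=
  if (G - A) *ᵥ u = 0 then G
  else G - (u ⬝ᵥ ((G - A) *ᵥ u))⁻¹ • Matrix.vecMulVec ((G - A) *ᵥ u) ((G - A) *ᵥ u)

/-- The Hessian matrix of `f` at `x`, with entries the second derivatives in the
standard basis directions. -/
noncomputable def hess {n : ℕ} (f : (Fin n → ℝ) → ℝ) (x : Fin n → ℝ) :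
    Matrix (Fin n) (Fin n) ℝ :=
  Matrix.of fun i j => iteratedFDeriv ℝ 2 f x ![Pi.single i 1, Pi.single j 1]

/-- The gradient of `f` at `x`. -/
noncomputable def grad {n : ℕ} (f : (Fin n → ℝ) → ℝ) (x : Fin n → ℝ) : Fin n → ℝ :=
  fun i => fderiv ℝ f x (Pi.single i 1)

/-- The local norm `‖v‖_z = √(vᵀ ∇²f(z) v)`. -/
noncomputable def znorm {n : ℕ} (f : (Fin n → ℝ) → ℝ) (z v : Fin n → ℝ) : ℝ :=
  Real.sqrt (v ⬝ᵥ (hess f z *ᵥ v))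

/-- The local gradient norm `λ_f(x) = √(∇f(x)ᵀ [∇²f(x)]⁻¹ ∇f(x))`. -/
noncomputable def lamG {n : ℕ} (f : (Fin n → ℝ) → ℝ) (x : Fin n → ℝ) : ℝ :=
  Real.sqrt (grad f x ⬝ᵥ ((hess f x)⁻¹ *ᵥ grad f x))

/-- `f` is `M`-strongly self-concordant:
`∇²f(y) − ∇²f(x) ⪯ M‖y−x‖_z ∇²f(w)` for all `x, y, z, w`. -/
def StrongSelfConcordant {n : ℕ} (f : (Fin n → ℝ) → ℝ) (M : ℝ) : Prop :=
  ∀ x y z w : Fin n → ℝ,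
    ((M * znorm f z (y - x)) • hess f w - (hess f y - hess f x)).PosSemidef

/-- The averaged Hessian `J_k = ∫₀¹ ∇²f(x_k + t u_k) dt` (entrywise integral),
where `u_k = x_{k+1} − x_k`. -/
noncomputable def Jmat {n : ℕ} (f : (Fin n → ℝ) → ℝ) (x : ℕ → Fin n → ℝ) (k : ℕ) :
    Matrix (Fin n) (Fin n) ℝ :=
  Matrix.of fun i j => ∫ t in (0:ℝ)..(1:ℝ), hess f (x k + t • (x (k+1) - x k)) i j

section QuadraticForms

variable {n : ℕ} {A B G J : Matrix (Fin n) (Fin n) ℝ}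

lemma posSemidef_iff_isSymm_and_nonneg :
    A.PosSemidef ↔ A.IsSymm ∧ ∀ v, 0 ≤ v ⬝ᵥ (A *ᵥ v) := by
  rw [posSemidef_iff_dotProduct_mulVec, IsHermitian, conjTranspose_eq_transpose_of_trivial]
  rfl

lemma Matrix.PosSemidef.isSymm (hA : A.PosSemidef) : A.IsSymm :=
  (posSemidef_iff_isSymm_and_nonneg.1 hA).1

lemma Matrix.PosSemidef.quadForm_nonneg (hA : A.PosSemidef) (v : Fin n → ℝ) :
    0 ≤ v ⬝ᵥ (A *ᵥ v) :=
  (posSemidef_iff_isSymm_and_nonneg.1 hA).2 v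

lemma Matrix.PosDef.isSymm (hA : A.PosDef) : A.IsSymm := hA.posSemidef.isSymm

lemma posSemidef_sub_iff (hA : A.IsSymm) (hB : B.IsSymm) :
    (B - A).PosSemidef ↔ ∀ v, v ⬝ᵥ (A *ᵥ v) ≤ v ⬝ᵥ (B *ᵥ v) := by
  rw [posSemidef_iff_isSymm_and_nonneg]
  simp [hB.sub hA, sub_mulVec, dotProduct_sub]

lemma quadForm_le_of_posSemidef_sub (h : (B - A).PosSemidef) (v : Fin n → ℝ) :
    v ⬝ᵥ (A *ᵥ v) ≤ v ⬝ᵥ (B *ᵥ v) := by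
  have := h.quadForm_nonneg v
  simpa [sub_mulVec, dotProduct_sub] using this

lemma Matrix.IsSymm.bilin_comm (hA : A.IsSymm) (v w : Fin n → ℝ) :
    v ⬝ᵥ (A *ᵥ w) = w ⬝ᵥ (A *ᵥ v) := by
  rw [dotProduct_mulVec, dotProduct_comm, ← mulVec_transpose, hA.eq]

lemma Matrix.PosSemidef.loewner_trans {C : Matrix (Fin n) (Fin n) ℝ}
    (hBA : (B - A).PosSemidef) (hCB : (C - B).PosSemidef) : (C - A).PosSemidef := by
  simpa using hCB.add hBA

lemma posDef_of_sub_smul_one {m : ℝ} (hm : 0 < m)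
    (h : (A - m • (1 : Matrix (Fin n) (Fin n) ℝ)).PosSemidef) : A.PosDef := by
  have := PosDef.posSemidef_add h (PosDef.one.smul hm)
  simpa using this

lemma mulVec_inv_mulVec (hA : A.PosDef) (v : Fin n → ℝ) : A *ᵥ (A⁻¹ *ᵥ v) = v := by
  rw [mulVec_mulVec, mul_nonsing_inv _ hA.det_pos.ne'.isUnit, one_mulVec]

lemma inv_mulVec_mulVec (hA : A.PosDef) (v : Fin n → ℝ) : A⁻¹ *ᵥ (A *ᵥ v) = v := by
  rw [mulVec_mulVec, nonsing_inv_mul _ hA.det_pos.ne'.isUnit, one_mulVec]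

/-- Inversion reverses the Loewner order, up to scaling. -/
lemma quadForm_inv_le_mul {t : ℝ} (ht : 0 < t) (hA : A.PosDef) (hB : B.PosDef)
    (hAB : (t • B - A).PosSemidef) (g : Fin n → ℝ) :
    g ⬝ᵥ (B⁻¹ *ᵥ g) ≤ t * (g ⬝ᵥ (A⁻¹ *ᵥ g)) := by
  obtain ⟨y, hy⟩ : ∃ y, y = B⁻¹ *ᵥ g := ⟨_, rfl⟩
  obtain ⟨z, hz⟩ : ∃ z, z = A⁻¹ *ᵥ g := ⟨_, rfl⟩
  have hBy : B *ᵥ y = g := by rw [hy, mulVec_inv_mulVec hB]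
  have hAz : A *ᵥ z = g := by rw [hz, mulVec_inv_mulVec hA]
  have h1 := hA.posSemidef.quadForm_nonneg (t • z - y)
  have h2 := quadForm_le_of_posSemidef_sub hAB y
  have h3 := hA.isSymm.bilin_comm z y
  simp only [mulVec_sub, mulVec_smul, dotProduct_sub, sub_dotProduct, dotProduct_smul,
    smul_dotProduct, smul_eq_mul, smul_mulVec, hBy, hAz] at h1 h2 h3
  rw [← hy, ← hz, dotProduct_comm g y, dotProduct_comm g z]
  rw [h3] at h1
  have h4 : 0 ≤ t * (t * (z ⬝ᵥ g) - y ⬝ᵥ g) := by linarith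
  have h5 := nonneg_of_mul_nonneg_right h4 ht
  linarith

lemma Matrix.PosSemidef.mulVec_eq_zero (hA : A.PosSemidef) {v : Fin n → ℝ}
    (h : v ⬝ᵥ (A *ᵥ v) = 0) : A *ᵥ v = 0 := by
  simpa [h] using hA.dotProduct_mulVec_zero_iff v

/-- Cauchy–Schwarz for a positive semidefinite form. -/
lemma Matrix.PosSemidef.bilin_sq_le (hA : A.PosSemidef) (v w : Fin n → ℝ) :
    (v ⬝ᵥ (A *ᵥ w)) ^ 2 ≤ (v ⬝ᵥ (A *ᵥ v)) * (w ⬝ᵥ (A *ᵥ w)) := by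
  have h : ∀ x : ℝ, 0 ≤ (w ⬝ᵥ (A *ᵥ w)) * (x * x) + (2 * (v ⬝ᵥ (A *ᵥ w))) * x
      + v ⬝ᵥ (A *ᵥ v) := by
    intro x
    have h1 := hA.quadForm_nonneg (v + x • w)
    have h2 := hA.isSymm.bilin_comm w v
    simp only [mulVec_add, mulVec_smul, dotProduct_add, add_dotProduct, dotProduct_smul,
      smul_dotProduct, smul_eq_mul] at h1
    rw [h2] at h1
    linarith
  have := discrim_le_zero h
  unfold discrim at this
  linarith

lemma pow_le_det {m : ℝ} (hm : 0 < m)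
    (h : (A - m • (1 : Matrix (Fin n) (Fin n) ℝ)).PosSemidef) : m ^ n ≤ A.det := by
  have hA := posDef_of_sub_smul_one hm h
  have hev : ∀ i, m ≤ hA.isHermitian.eigenvalues i := by
    intro i
    set v : Fin n → ℝ := (hA.isHermitian.eigenvectorBasis i).ofLp with hv
    have h1 := quadForm_le_of_posSemidef_sub h v
    have h2 : A *ᵥ v = hA.isHermitian.eigenvalues i • v :=
      hA.isHermitian.mulVec_eigenvectorBasis i
    have h3 : v ⬝ᵥ v = 1 := by
      have h4 := hA.isHermitian.eigenvectorBasis.orthonormal.1 i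
      have h5 := EuclideanSpace.real_norm_sq_eq (hA.isHermitian.eigenvectorBasis i)
      rw [h4] at h5
      simp only [dotProduct, hv, ← pow_two]
      linarith
    rw [h2, smul_mulVec, one_mulVec, dotProduct_smul, dotProduct_smul, h3] at h1
    simpa using h1
  rw [hA.isHermitian.det_eq_prod_eigenvalues]
  calc m ^ n = ∏ _i : Fin n, m := by simp
    _ ≤ _ := Finset.prod_le_prod (fun _ _ => hm.le) (fun i _ => by simpa using hev i)

lemma det_add_smul_vecMulVec (hA : A.PosDef) (c : ℝ) (w : Fin n → ℝ) :
    (A + c • vecMulVec w w).det = A.det * (1 + c * (w ⬝ᵥ (A⁻¹ *ᵥ w))) := by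
  rw [← smul_vecMulVec, vecMulVec_eq Unit,
    det_add_replicateCol_mul_replicateRow hA.det_pos.ne'.isUnit]
  congr 1
  rw [det_unique]
  rw [Matrix.mul_assoc, ← replicateCol_mulVec, mulVec_smul]
  simp [mul_apply, dotProduct]

/-- If `(1 - ρ) G ⪯ J ⪯ (1 + ρ) G`, the map `G u ↦ (J - G) u` contracts the norm of `J⁻¹`
by the factor `ρ`. -/
lemma quadForm_inv_sub_mulVec_le {ρ : ℝ} (hρ0 : 0 < ρ) (hρ1 : ρ ≤ 1)
    (hJ : J.PosDef) (hG : G.IsSymm)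
    (hlow : (J - (1 - ρ) • G).PosSemidef) (hup : ((1 + ρ) • G - J).PosSemidef)
    (u : Fin n → ℝ) :
    ((J - G) *ᵥ u) ⬝ᵥ (J⁻¹ *ᵥ ((J - G) *ᵥ u)) ≤ ρ ^ 2 * ((G *ᵥ u) ⬝ᵥ (J⁻¹ *ᵥ (G *ᵥ u))) := by
  obtain ⟨z, hz⟩ : ∃ z, z = J⁻¹ *ᵥ (G *ᵥ u) := ⟨_, rfl⟩
  have hJz : J *ᵥ z = G *ᵥ u := by rw [hz, mulVec_inv_mulVec hJ]
  have e1 : J⁻¹ *ᵥ ((J - G) *ᵥ u) = u - z := by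
    rw [sub_mulVec, mulVec_sub, inv_mulVec_mulVec hJ, hz]
  rw [e1, ← hz, sub_mulVec]
  have hp := hlow.quadForm_nonneg ((1 + ρ) • z - u)
  have hq := hup.quadForm_nonneg (u - (1 - ρ) • z)
  have s1 := hJ.isSymm.bilin_comm z u
  have s2 := hG.bilin_comm z u
  simp only [mulVec_sub, mulVec_smul, dotProduct_sub, sub_dotProduct, dotProduct_smul,
    smul_dotProduct, smul_eq_mul, smul_mulVec, sub_mulVec, hJz] at hp hq ⊢
  have s3 := dotProduct_comm (G *ᵥ u) z
  have s4 := dotProduct_comm (G *ᵥ u) u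
  have s5 := dotProduct_comm (J *ᵥ u) z
  have s6 := dotProduct_comm (J *ᵥ u) u
  rw [hJz] at s1
  rw [s1, ← s2] at hp hq
  rw [s3, s4, s5, s6, s1]
  have h1 := mul_nonneg (sub_nonneg.2 hρ1) hp
  have h2 := mul_nonneg (by linarith : 0 ≤ 1 + ρ) hq
  have h : 0 ≤ (2 * ρ) * (ρ ^ 2 * (z ⬝ᵥ (G *ᵥ u)) - (u ⬝ᵥ (J *ᵥ u) - u ⬝ᵥ (G *ᵥ u)
      - (u ⬝ᵥ (G *ᵥ u) - z ⬝ᵥ (G *ᵥ u)))) := by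
    linarith
  have h3 := nonneg_of_mul_nonneg_right h (by linarith)
  linarith

end QuadraticForms

section SR1Update

variable {n : ℕ} {A G J : Matrix (Fin n) (Fin n) ℝ} {u : Fin n → ℝ}

lemma SR1_of_ne (h : (G - A) *ᵥ u ≠ 0) :
    SR1 A G u = G - (u ⬝ᵥ ((G - A) *ᵥ u))⁻¹ •
      vecMulVec ((G - A) *ᵥ u) ((G - A) *ᵥ u) := if_neg h

lemma SR1_of_eq (h : (G - A) *ᵥ u = 0) : SR1 A G u = G := if_pos h

lemma quadForm_pos_of_mulVec_ne_zero (hA : A.PosSemidef) (h : A *ᵥ u ≠ 0) :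
    0 < u ⬝ᵥ (A *ᵥ u) :=
  (hA.quadForm_nonneg u).lt_of_ne' fun h0 => h (hA.mulVec_eq_zero h0)

lemma posSemidef_vecMulVec_self (w : Fin n → ℝ) : (vecMulVec w w).PosSemidef := by
  simpa using posSemidef_vecMulVec_self_star w

lemma sub_SR1_posSemidef (h : (G - A).PosSemidef) : (G - SR1 A G u).PosSemidef := by
  by_cases h0 : (G - A) *ᵥ u = 0
  · rw [SR1_of_eq h0, sub_self]
    exact PosSemidef.zero
  · rw [SR1_of_ne h0, sub_sub_cancel]
    exact (posSemidef_vecMulVec_self _).smul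
      (inv_nonneg.2 (quadForm_pos_of_mulVec_ne_zero h h0).le)

lemma SR1_sub_posSemidef (h : (G - A).PosSemidef) : (SR1 A G u - A).PosSemidef := by
  by_cases h0 : (G - A) *ᵥ u = 0
  · rwa [SR1_of_eq h0]
  · have hs := quadForm_pos_of_mulVec_ne_zero h h0
    rw [SR1_of_ne h0, sub_right_comm]
    refine (posSemidef_sub_iff ((posSemidef_vecMulVec_self _).isSymm.smul _) h.isSymm).2
      fun v => ?_
    have hcs := h.bilin_sq_le v u
    rw [smul_mulVec, vecMulVec_mulVec]
    simp only [dotProduct_smul, MulOpposite.smul_eq_mul_unop, MulOpposite.unop_op, smul_eq_mul]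
    rw [dotProduct_comm _ v, inv_mul_le_iff₀ hs]
    linarith

lemma SR1_mulVec (h : (G - A).PosSemidef) : SR1 A G u *ᵥ u = A *ᵥ u := by
  by_cases h0 : (G - A) *ᵥ u = 0
  · rw [SR1_of_eq h0]
    rwa [sub_mulVec, sub_eq_zero] at h0
  · have hs := quadForm_pos_of_mulVec_ne_zero h h0
    rw [SR1_of_ne h0, sub_mulVec, smul_mulVec, vecMulVec_mulVec, op_smul_eq_smul, smul_smul,
      dotProduct_comm _ u, inv_mul_cancel₀ hs.ne', one_smul, sub_mulVec, sub_sub_cancel]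

/-- The determinant ratio of an SR1 step measures the progress of the step. -/
lemma SR1_det_ratio (hA : A.PosDef) (h : (G - A).PosSemidef) :
    1 ≤ G.det / (SR1 A G u).det ∧
      (G *ᵥ u) ⬝ᵥ ((SR1 A G u)⁻¹ *ᵥ (G *ᵥ u)) =
        u ⬝ᵥ (G *ᵥ u) + (u ⬝ᵥ ((G - A) *ᵥ u)) * (G.det / (SR1 A G u).det) := by
  have hS : (SR1 A G u).PosDef := by
    simpa using PosDef.add_posSemidef hA (SR1_sub_posSemidef (u := u) h)
  by_cases h0 : (G - A) *ᵥ u = 0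
  · rw [SR1_of_eq h0] at hS ⊢
    rw [div_self hS.det_pos.ne', inv_mulVec_mulVec hS, h0, dotProduct_comm]
    simp
  · have hs := quadForm_pos_of_mulVec_ne_zero h h0
    set S := SR1 A G u with hSdef
    set s := u ⬝ᵥ ((G - A) *ᵥ u) with hsdef
    set w := (G - A) *ᵥ u with hw
    have hG : G = S + s⁻¹ • vecMulVec w w := by rw [hSdef, SR1_of_ne h0]; simp [← hw, ← hsdef]
    have hdet : G.det / S.det = 1 + s⁻¹ * (w ⬝ᵥ (S⁻¹ *ᵥ w)) := by
      conv_lhs => rw [hG]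
      rw [det_add_smul_vecMulVec hS, mul_div_cancel_left₀ _ hS.det_pos.ne']
    have hSu : S *ᵥ u = A *ᵥ u := SR1_mulVec h
    have hw' : w = G *ᵥ u - S *ᵥ u := by rw [hw, sub_mulVec, hSu]
    have hSw : S⁻¹ *ᵥ w = S⁻¹ *ᵥ (G *ᵥ u) - u := by
      rw [hw', mulVec_sub, inv_mulVec_mulVec hS]
    have hsu : s = u ⬝ᵥ (G *ᵥ u) - u ⬝ᵥ (S *ᵥ u) := by rw [hsdef, hw', dotProduct_sub]
    have hc : (S *ᵥ u) ⬝ᵥ (S⁻¹ *ᵥ (G *ᵥ u)) = u ⬝ᵥ (G *ᵥ u) := by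
      rw [dotProduct_comm (S *ᵥ u), hS.isSymm.bilin_comm,
        mulVec_inv_mulVec hS]
    constructor
    · rw [hdet]
      have : 0 ≤ s⁻¹ * (w ⬝ᵥ (S⁻¹ *ᵥ w)) :=
        mul_nonneg (inv_nonneg.2 hs.le) (hS.inv.posSemidef.quadForm_nonneg w)
      linarith
    · rw [hdet, mul_add, ← mul_assoc, mul_inv_cancel₀ hs.ne', hSw, hw']
      simp only [sub_dotProduct, dotProduct_sub, hc]
      rw [dotProduct_comm (G *ᵥ u) u, dotProduct_comm (S *ᵥ u) u]
      linarith

lemma scaled_step_bound {a s c D : ℝ} (hs : 0 ≤ s) (hsa : s ≤ a) (hc : 1 ≤ c) (hD : 1 ≤ D) :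
    (a + s * D) / c ^ 2 - 2 * a / c + (a - s) ≤ a / c * (c * D - 1) := by
  obtain ⟨e, he⟩ : ∃ e, e = c⁻¹ := ⟨_, rfl⟩
  have he0 : 0 < e := by rw [he]; positivity
  have he1 : e ≤ 1 := by rw [he]; exact inv_le_one_of_one_le₀ hc
  have hce : c * e = 1 := by rw [he]; field_simp
  have hl : (a + s * D) / c ^ 2 - 2 * a / c + (a - s)
      = (a + s * D) * e ^ 2 - 2 * a * e + (a - s) := by
    rw [he]; field_simp
  have hr : a / c * (c * D - 1) = a * (D - e) := by
    rw [he]; field_simp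
  rw [hl, hr]
  have ha : 0 ≤ a := hs.trans hsa
  have hee : e ^ 2 ≤ e := by nlinarith
  rcases le_total 1 (D * e ^ 2) with h | h
  · have h1 : s * (D * e ^ 2 - 1) ≤ a * (D * e ^ 2 - 1) :=
      mul_le_mul_of_nonneg_right hsa (by linarith)
    have h2 : D * e ^ 2 ≤ D := by nlinarith
    have h3 : a * (D * e ^ 2 + e ^ 2) ≤ a * (D + e) := mul_le_mul_of_nonneg_left (by linarith) ha
    linarith
  · have h1 : s * (D * e ^ 2 - 1) ≤ 0 := mul_nonpos_of_nonneg_of_nonpos hs (by linarith)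
    have h3 : a * (1 + e ^ 2) ≤ a * (D + e) := mul_le_mul_of_nonneg_left (by linarith) ha
    linarith

/-- One corrected SR1 step contracts the residual norm in terms of the determinant ratio. -/
lemma corrected_SR1_step {c : ℝ} (hc : 1 ≤ c) (hJ : J.PosDef)
    (h : (c • G - J).PosSemidef) :
    ((J - G) *ᵥ u) ⬝ᵥ ((SR1 J (c • G) u)⁻¹ *ᵥ ((J - G) *ᵥ u)) ≤
      (u ⬝ᵥ (G *ᵥ u)) * (c * ((c • G).det / (SR1 J (c • G) u).det) - 1) := by
  obtain ⟨hD, hb⟩ := SR1_det_ratio (u := u) hJ h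
  have hSu := SR1_mulVec (u := u) h
  have hS : (SR1 J (c • G) u).PosDef := by
    simpa using PosDef.add_posSemidef hJ (SR1_sub_posSemidef (u := u) h)
  set D := (c • G).det / (SR1 J (c • G) u).det
  set S := SR1 J (c • G) u
  have hc0 : 0 < c := by linarith
  set y := (c • G) *ᵥ u with hy
  have hGu : G *ᵥ u = c⁻¹ • y := by
    rw [hy, smul_mulVec, smul_smul, inv_mul_cancel₀ hc0.ne', one_smul]
  have hv : (J - G) *ᵥ u = S *ᵥ u - c⁻¹ • y := by rw [sub_mulVec, hSu, hGu]
  have hSS : (S *ᵥ u) ⬝ᵥ (S⁻¹ *ᵥ y) = u ⬝ᵥ y := by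
    rw [dotProduct_comm (S *ᵥ u), hS.isSymm.bilin_comm,
      mulVec_inv_mulVec hS]
  have hs := h.quadForm_nonneg u
  have hJu := hJ.posSemidef.quadForm_nonneg u
  have e1 : u ⬝ᵥ ((c • G - J) *ᵥ u) = u ⬝ᵥ y - u ⬝ᵥ (J *ᵥ u) := by
    rw [sub_mulVec, dotProduct_sub, hy]
  have key := scaled_step_bound hs (by linarith : _ ≤ u ⬝ᵥ y) hc hD
  rw [← hb] at key
  have e2 : u ⬝ᵥ (G *ᵥ u) = u ⬝ᵥ y / c := by
    rw [hGu, dotProduct_smul, smul_eq_mul]; ring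
  rw [e2]
  refine le_trans (le_of_eq ?_) key
  rw [hv, mulVec_sub, inv_mulVec_mulVec hS, mulVec_smul]
  simp only [sub_dotProduct, dotProduct_sub, smul_dotProduct, dotProduct_smul, hSS, smul_eq_mul]
  rw [dotProduct_comm y u, dotProduct_comm (S *ᵥ u) u, e1, hSu]
  field_simp
  ring

end SR1Update

section AverageHessian

variable {n : ℕ} {f : (Fin n → ℝ) → ℝ}

/-- The average of the Hessian over the segment from `x` to `x + u`. -/
noncomputable def avgHess (f : (Fin n → ℝ) → ℝ) (x u : Fin n → ℝ) :
    Matrix (Fin n) (Fin n) ℝ :=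
  Matrix.of fun i j => ∫ t in (0:ℝ)..(1:ℝ), hess f (x + t • u) i j

lemma hess_apply (f : (Fin n → ℝ) → ℝ) (x : Fin n → ℝ) (i j : Fin n) :
    hess f x i j = fderiv ℝ (fderiv ℝ f) x (Pi.single i 1) (Pi.single j 1) := by
  simp [hess, iteratedFDeriv_two_apply]

lemma contDiff_fderiv_one (hf : ContDiff ℝ 2 f) : ContDiff ℝ 1 (fderiv ℝ f) :=
  hf.fderiv_right (by norm_num)

lemma continuous_hess_apply (hf : ContDiff ℝ 2 f) (i j : Fin n) :
    Continuous fun x => hess f x i j := by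
  simp only [hess_apply]
  have : Continuous (fderiv ℝ (fderiv ℝ f)) :=
    (contDiff_fderiv_one hf).continuous_fderiv one_ne_zero
  fun_prop

lemma continuous_hess_segment (hf : ContDiff ℝ 2 f) (x u : Fin n → ℝ) (i j : Fin n) :
    Continuous fun t : ℝ => hess f (x + t • u) i j :=
  (continuous_hess_apply hf i j).comp (by fun_prop)

lemma continuous_quadForm_segment (hf : ContDiff ℝ 2 f) (x u v : Fin n → ℝ) :
    Continuous fun t : ℝ => v ⬝ᵥ (hess f (x + t • u) *ᵥ v) := by
  simp only [dotProduct, mulVec]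
  have := continuous_hess_segment hf x u
  fun_prop

lemma avgHess_mulVec (hf : ContDiff ℝ 2 f) (x u v : Fin n → ℝ) (i : Fin n) :
    (avgHess f x u *ᵥ v) i = ∫ t in (0:ℝ)..(1:ℝ), (hess f (x + t • u) *ᵥ v) i := by
  have := continuous_hess_segment hf x u
  simp only [mulVec, dotProduct, avgHess, of_apply]
  rw [intervalIntegral.integral_finsetSum]
  · simp [intervalIntegral.integral_mul_const]
  · intro j _
    exact ((this i j).mul continuous_const).intervalIntegrable _ _

lemma quadForm_avgHess (hf : ContDiff ℝ 2 f) (x u v : Fin n → ℝ) :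
    v ⬝ᵥ (avgHess f x u *ᵥ v) = ∫ t in (0:ℝ)..(1:ℝ), v ⬝ᵥ (hess f (x + t • u) *ᵥ v) := by
  have := continuous_hess_segment hf x u
  rw [dotProduct]
  simp only [avgHess_mulVec hf]
  simp only [dotProduct]
  rw [intervalIntegral.integral_finsetSum]
  · simp [intervalIntegral.integral_const_mul]
  · intro j _
    apply Continuous.intervalIntegrable
    simp only [mulVec, dotProduct]
    fun_prop

lemma avgHess_isSymm (hsymm : ∀ y, (hess f y).IsSymm) (x u : Fin n → ℝ) :
    (avgHess f x u).IsSymm := by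
  ext i j
  simp only [transpose_apply, avgHess, of_apply, (hsymm _).apply i j]

lemma hess_mulVec_apply (hsymm : ∀ y, (hess f y).IsSymm) (y u : Fin n → ℝ) (i : Fin n) :
    (hess f y *ᵥ u) i = fderiv ℝ (fderiv ℝ f) y u (Pi.single i 1) := by
  have hu : u = ∑ j, u j • (Pi.single j (1 : ℝ) : Fin n → ℝ) := by
    conv_lhs => rw [pi_eq_sum_univ' u]
  have hL : fderiv ℝ (fderiv ℝ f) y u (Pi.single i 1) =
      ∑ j, u j * fderiv ℝ (fderiv ℝ f) y (Pi.single j 1) (Pi.single i 1) := by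
    conv_lhs => rw [hu]
    rw [map_sum, _root_.sum_apply]
    simp only [map_smul, _root_.smul_apply, smul_eq_mul]
  rw [hL, mulVec, dotProduct]
  refine Finset.sum_congr rfl fun j _ => ?_
  rw [← (hsymm y).apply i j, hess_apply, mul_comm]

lemma hasDerivAt_grad_segment (hf : ContDiff ℝ 2 f) (hsymm : ∀ y, (hess f y).IsSymm)
    (x u : Fin n → ℝ) (i : Fin n) (t : ℝ) :
    HasDerivAt (fun t : ℝ => grad f (x + t • u) i) ((hess f (x + t • u) *ᵥ u) i) t := by
  have h1 : DifferentiableAt ℝ (fderiv ℝ f) (x + t • u) :=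
    ((contDiff_fderiv_one hf).differentiable one_ne_zero) _
  have h2 : HasDerivAt (fun t : ℝ => x + t • u) u t := by
    simpa using ((hasDerivAt_id t).smul_const u).const_add x
  have h3 : HasFDerivAt (fun y => grad f y i)
      ((ContinuousLinearMap.apply ℝ ℝ (Pi.single i (1 : ℝ) : Fin n → ℝ)).comp
        (fderiv ℝ (fderiv ℝ f) (x + t • u))) (x + t • u) :=
    (ContinuousLinearMap.apply ℝ ℝ (Pi.single i (1 : ℝ) : Fin n → ℝ)).hasFDerivAt.comp
      (x + t • u) h1.hasFDerivAt
  rw [hess_mulVec_apply hsymm]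
  exact h3.comp_hasDerivAt t h2

/-- The mean value identity for the gradient. -/
lemma avgHess_mulVec_self (hf : ContDiff ℝ 2 f) (hsymm : ∀ y, (hess f y).IsSymm)
    (x u : Fin n → ℝ) : avgHess f x u *ᵥ u = grad f (x + u) - grad f x := by
  ext i
  have hc := continuous_hess_segment hf x u
  rw [avgHess_mulVec hf, intervalIntegral.integral_eq_sub_of_hasDerivAt
    (fun t _ => hasDerivAt_grad_segment hf hsymm x u i t)]
  · simp
  · apply Continuous.intervalIntegrable
    simp only [mulVec, dotProduct]
    fun_prop

lemma smul_one_le_avgHess {m : ℝ} (hf : ContDiff ℝ 2 f)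
    (hlow : ∀ y, (hess f y - m • (1 : Matrix (Fin n) (Fin n) ℝ)).PosSemidef)
    (hsymm : ∀ y, (hess f y).IsSymm) (x u : Fin n → ℝ) :
    (avgHess f x u - m • (1 : Matrix (Fin n) (Fin n) ℝ)).PosSemidef := by
  refine (posSemidef_sub_iff (isSymm_one.smul m) (avgHess_isSymm hsymm x u)).2 fun v => ?_
  rw [quadForm_avgHess hf]
  have h := intervalIntegral.integral_mono_on (μ := MeasureTheory.volume) (a := 0) (b := 1)
    (f := fun _ => v ⬝ᵥ ((m • (1 : Matrix (Fin n) (Fin n) ℝ)) *ᵥ v))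
    (zero_le_one' ℝ) intervalIntegrable_const ((continuous_quadForm_segment hf x u v).intervalIntegrable _ _)
    (fun t _ => quadForm_le_of_posSemidef_sub (hlow (x + t • u)) v)
  simpa using h

/-- A function on `[0, 1]` with relative deviation `K t` from its value at `0` is comparable with
its mean. -/
lemma mean_comparison {φ : ℝ → ℝ} {K : ℝ} (hφ : Continuous φ)
    (h1 : ∀ t ∈ Set.Icc (0:ℝ) 1, φ t - φ 0 ≤ K * t * φ 0)
    (h2 : ∀ t ∈ Set.Icc (0:ℝ) 1, ∀ s ∈ Set.Icc (0:ℝ) 1, φ 0 - φ t ≤ K * t * φ s) :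
    (∫ t in (0:ℝ)..1, φ t) ≤ (1 + K / 2) * φ 0 ∧
      φ 0 ≤ (1 + K / 2) * ∫ t in (0:ℝ)..1, φ t := by
  have hlin : ∀ b : ℝ, ∫ t in (0:ℝ)..1, K * t * b = K / 2 * b := by
    intro b
    rw [intervalIntegral.integral_mul_const, intervalIntegral.integral_const_mul, integral_id]
    ring
  constructor
  · have h := intervalIntegral.integral_mono_on (μ := MeasureTheory.volume) (a := 0) (b := 1) (zero_le_one' ℝ)
      ((by fun_prop : Continuous fun t => φ t - φ 0).intervalIntegrable _ _)
      ((by fun_prop : Continuous fun t => K * t * φ 0).intervalIntegrable _ _) h1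
    rw [hlin, intervalIntegral.integral_sub (hφ.intervalIntegrable _ _)
      intervalIntegrable_const] at h
    simp only [intervalIntegral.integral_const, sub_zero, one_smul] at h
    linarith
  · have h : ∀ s ∈ Set.Icc (0:ℝ) 1, φ 0 - (∫ t in (0:ℝ)..1, φ t) ≤ K / 2 * φ s := by
      intro s hs
      have h := intervalIntegral.integral_mono_on (μ := MeasureTheory.volume) (a := 0) (b := 1) (zero_le_one' ℝ)
        ((by fun_prop : Continuous fun t => φ 0 - φ t).intervalIntegrable _ _)
        ((by fun_prop : Continuous fun t => K * t * φ s).intervalIntegrable _ _) (fun t ht => h2 t ht s hs)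
      rw [hlin, intervalIntegral.integral_sub intervalIntegrable_const (hφ.intervalIntegrable _ _)] at h
      simpa only [intervalIntegral.integral_const, sub_zero, one_smul] using h
    have h' := intervalIntegral.integral_mono_on (μ := MeasureTheory.volume) (a := 0) (b := 1) (zero_le_one' ℝ)
      intervalIntegrable_const (Continuous.intervalIntegrable (by fun_prop) _ _) h
    rw [intervalIntegral.integral_const_mul] at h'
    simp only [intervalIntegral.integral_const, sub_zero, one_smul] at h'
    linarith

lemma znorm_smul (z v : Fin n → ℝ) {t : ℝ} (ht : 0 ≤ t) : znorm f z (t • v) = t * znorm f z v := by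
  unfold znorm
  rw [mulVec_smul, dotProduct_smul, smul_dotProduct, smul_eq_mul, smul_eq_mul, ← mul_assoc,
    Real.sqrt_mul (mul_self_nonneg t), Real.sqrt_mul_self ht]

lemma znorm_neg (z v : Fin n → ℝ) : znorm f z (-v) = znorm f z v := by
  simp [znorm, mulVec_neg]

lemma StrongSelfConcordant.quadForm_sub_le {M : ℝ} (h : StrongSelfConcordant f M)
    (x y z w v : Fin n → ℝ) :
    v ⬝ᵥ (hess f y *ᵥ v) - v ⬝ᵥ (hess f x *ᵥ v) ≤
      M * znorm f z (y - x) * (v ⬝ᵥ (hess f w *ᵥ v)) := by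
  have := quadForm_le_of_posSemidef_sub (h x y z w) v
  rwa [sub_mulVec, dotProduct_sub, smul_mulVec, dotProduct_smul, smul_eq_mul] at this

lemma StrongSelfConcordant.avgHess_comparison_left {M : ℝ} (hf : ContDiff ℝ 2 f)
    (h : StrongSelfConcordant f M) (hsymm : ∀ y, (hess f y).IsSymm) (x u : Fin n → ℝ) :
    ((1 + M * znorm f x u / 2) • hess f x - avgHess f x u).PosSemidef ∧
      ((1 + M * znorm f x u / 2) • avgHess f x u - hess f x).PosSemidef := by
  have hJ := avgHess_isSymm hsymm x u
  rw [posSemidef_sub_iff hJ ((hsymm x).smul _), posSemidef_sub_iff (hsymm x) (hJ.smul _),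
    ← forall_and]
  intro v
  have key := mean_comparison (K := M * znorm f x u) (continuous_quadForm_segment hf x u v)
    (fun t ht => by
      have := h.quadForm_sub_le x (x + t • u) x x v
      rw [add_sub_cancel_left, znorm_smul _ _ ht.1] at this
      simpa [mul_assoc, mul_left_comm] using this)
    (fun t ht s _ => by
      have := h.quadForm_sub_le (x + t • u) x x (x + s • u) v
      rw [sub_add_cancel_left, znorm_neg, znorm_smul _ _ ht.1] at this
      simpa [mul_assoc, mul_left_comm] using this)
  simpa [smul_mulVec, quadForm_avgHess hf] using key

lemma StrongSelfConcordant.avgHess_comparison_right {M : ℝ} (hf : ContDiff ℝ 2 f)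
    (h : StrongSelfConcordant f M) (hsymm : ∀ y, (hess f y).IsSymm) (x u : Fin n → ℝ) :
    ((1 + M * znorm f x u / 2) • hess f (x + u) - avgHess f x u).PosSemidef ∧
      ((1 + M * znorm f x u / 2) • avgHess f x u - hess f (x + u)).PosSemidef := by
  have hJ := avgHess_isSymm hsymm x u
  rw [posSemidef_sub_iff hJ ((hsymm _).smul _), posSemidef_sub_iff (hsymm _) (hJ.smul _),
    ← forall_and]
  intro v
  have e1 : ∀ t : ℝ, x + (1 - t) • u - (x + u) = -(t • u) := by
    intro t; rw [sub_smul, one_smul]; abel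
  have e2 : ∀ t : ℝ, x + u - (x + (1 - t) • u) = t • u := by
    intro t; rw [sub_smul, one_smul]; abel
  have key := mean_comparison (K := M * znorm f x u)
    (φ := fun t => v ⬝ᵥ (hess f (x + (1 - t) • u) *ᵥ v))
    ((continuous_quadForm_segment hf x u v).comp (by fun_prop : Continuous fun t : ℝ => 1 - t))
    (fun t ht => by
      have := h.quadForm_sub_le (x + u) (x + (1 - t) • u) x (x + u) v
      rw [e1, znorm_neg, znorm_smul _ _ ht.1] at this
      simpa [mul_assoc, mul_left_comm] using this)
    (fun t ht s _ => by
      have := h.quadForm_sub_le (x + (1 - t) • u) (x + u) x (x + (1 - s) • u) v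
      rw [e2, znorm_smul _ _ ht.1] at this
      simpa [mul_assoc, mul_left_comm] using this)
  rw [intervalIntegral.integral_comp_sub_left
    (fun t => v ⬝ᵥ (hess f (x + t • u) *ᵥ v))] at key
  simpa [smul_mulVec, quadForm_avgHess hf] using key

end AverageHessian

section Convergence

lemma prod_sub_one_le {k : ℕ} (hk : 1 ≤ k) {y : ℕ → ℝ} {X : ℝ} (hy : ∀ i, 1 ≤ y i)
    (hX : ∏ i ∈ Finset.range k, y i ≤ Real.exp X) :
    ∏ i ∈ Finset.range k, (y i - 1) ≤ (Real.exp (X / k) - 1) ^ k := by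
  have hk0 : (k : ℝ) ≠ 0 := by positivity
  have hy0 : ∀ i, 0 < y i := fun i => by linarith [hy i]
  set e : ℝ := (k : ℝ)⁻¹ with he
  set P := ∏ i ∈ Finset.range k, (y i - 1) with hP
  set Q := ∏ i ∈ Finset.range k, y i with hQ
  have hP0 : 0 ≤ P := Finset.prod_nonneg fun i _ => by linarith [hy i]
  have hQ0 : 0 < Q := Finset.prod_pos fun i _ => hy0 i
  have hw : ∑ _i ∈ Finset.range k, e = 1 := by simp [he, hk0]
  have h1 := Real.geom_mean_le_arith_mean_weighted (Finset.range k) (fun _ => e)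
    (fun i => (y i - 1) / y i) (fun _ _ => by positivity) hw
    (fun i _ => div_nonneg (by linarith [hy i]) (hy0 i).le)
  have h2 := Real.geom_mean_le_arith_mean_weighted (Finset.range k) (fun _ => e)
    (fun i => 1 / y i) (fun _ _ => by positivity) hw
    (fun i _ => div_nonneg zero_le_one (hy0 i).le)
  rw [Real.finsetProd_rpow _ _ (fun i _ => div_nonneg (by linarith [hy i]) (hy0 i).le),
    Finset.prod_div_distrib, Real.div_rpow hP0 hQ0.le] at h1
  rw [Real.finsetProd_rpow _ _ (fun i _ => div_nonneg zero_le_one (hy0 i).le),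
    Finset.prod_div_distrib, Finset.prod_const_one, Real.div_rpow zero_le_one hQ0.le,
    Real.one_rpow] at h2
  have hsum : ∑ i ∈ Finset.range k, e * ((y i - 1) / y i)
      + ∑ i ∈ Finset.range k, e * (1 / y i) = 1 := by
    rw [← Finset.sum_add_distrib, ← hw]
    refine Finset.sum_congr rfl fun i _ => ?_
    have := (hy0 i).ne'
    field_simp
    ring
  have hQe : 0 < Q ^ e := Real.rpow_pos_of_pos hQ0 e
  have h3 : P ^ e / Q ^ e + 1 / Q ^ e ≤ 1 := by linarith
  rw [← add_div, div_le_one hQe] at h3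
  have h4 : Q ^ e ≤ Real.exp (X / k) := by
    calc Q ^ e ≤ (Real.exp X) ^ e := Real.rpow_le_rpow hQ0.le hX (by positivity)
      _ = Real.exp (X / k) := by rw [← Real.exp_mul, he, div_eq_mul_inv]
  calc P = (P ^ e) ^ k := (Real.rpow_inv_natCast_pow hP0 (by omega)).symm
    _ ≤ _ := pow_le_pow_left₀ (Real.rpow_nonneg hP0 e) (by linarith) k

variable {n : ℕ} {f : (Fin n → ℝ) → ℝ}

lemma lamG_nonneg (x : Fin n → ℝ) : 0 ≤ lamG f x := Real.sqrt_nonneg _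

lemma lamG_sq {x : Fin n → ℝ} (hH : (hess f x).PosDef) :
    lamG f x ^ 2 = grad f x ⬝ᵥ ((hess f x)⁻¹ *ᵥ grad f x) :=
  Real.sq_sqrt (hH.inv.posSemidef.quadForm_nonneg _)

lemma znorm_sq {z v : Fin n → ℝ} (hH : (hess f z).PosDef) :
    znorm f z v ^ 2 = v ⬝ᵥ (hess f z *ᵥ v) :=
  Real.sq_sqrt (hH.posSemidef.quadForm_nonneg _)

variable {M : ℝ} {G : Matrix (Fin n) (Fin n) ℝ} {x u : Fin n → ℝ}

lemma quadForm_eq_of_newton (hG : G.PosDef) (hu : u = -(G⁻¹ *ᵥ grad f x)) :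
    u ⬝ᵥ (G *ᵥ u) = grad f x ⬝ᵥ (G⁻¹ *ᵥ grad f x) := by
  rw [hu, mulVec_neg, mulVec_inv_mulVec hG, dotProduct_comm]
  simp

lemma grad_newton (hf : ContDiff ℝ 2 f) (hsymm : ∀ y, (hess f y).IsSymm) (hG : G.PosDef)
    (hu : u = -(G⁻¹ *ᵥ grad f x)) :
    grad f (x + u) = (avgHess f x u - G) *ᵥ u := by
  have : G *ᵥ u = -grad f x := by rw [hu, mulVec_neg, mulVec_inv_mulVec hG]
  rw [sub_mulVec, this, avgHess_mulVec_self hf hsymm]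
  abel

lemma znorm_newton_le {s : ℝ} (hs : 0 < s) (hH : (hess f x).PosDef) (hG : G.PosDef)
    (hHG : (s • G - hess f x).PosSemidef) (hu : u = -(G⁻¹ *ᵥ grad f x)) :
    znorm f x u ≤ s * lamG f x := by
  refine abs_le_of_sq_le_sq' ?_ (mul_nonneg hs.le (lamG_nonneg x)) |>.2
  have h1 := quadForm_le_of_posSemidef_sub hHG u
  have h2 := quadForm_inv_le_mul hs hH hG hHG (grad f x)
  rw [smul_mulVec, dotProduct_smul, smul_eq_mul, quadForm_eq_of_newton hG hu] at h1
  rw [znorm_sq hH, mul_pow, lamG_sq hH]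
  nlinarith

lemma StrongSelfConcordant.avgHess_le_smul {s : ℝ} (hf : ContDiff ℝ 2 f) (hM : 0 ≤ M)
    (h : StrongSelfConcordant f M) (hsymm : ∀ y, (hess f y).IsSymm)
    (hHG : (s • G - hess f x).PosSemidef) :
    ((s * (1 + M * znorm f x u / 2)) • G - avgHess f x u).PosSemidef := by
  have hr : 0 ≤ znorm f x u := Real.sqrt_nonneg _
  have h1 := hHG.smul (show 0 ≤ 1 + M * znorm f x u / 2 by positivity)
  rw [smul_sub, smul_smul, mul_comm] at h1
  exact (h.avgHess_comparison_left hf hsymm x u).1.loewner_trans h1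

lemma StrongSelfConcordant.lamG_newton_le {ρ : ℝ} (hf : ContDiff ℝ 2 f) (hM : 0 ≤ M)
    (h : StrongSelfConcordant f M) (hpos : ∀ y, (hess f y).PosDef)
    (hJ : (avgHess f x u).PosDef) (hG : G.PosDef) (hu : u = -(G⁻¹ *ᵥ grad f x))
    (hρ0 : 0 < ρ) (hρ1 : ρ ≤ 1)
    (hlow : (avgHess f x u - (1 - ρ) • G).PosSemidef)
    (hup : ((1 + ρ) • G - avgHess f x u).PosSemidef) :
    lamG f (x + u) ≤ (1 + M * znorm f x u / 2) * ρ * lamG f x := by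
  have hr : 0 ≤ znorm f x u := Real.sqrt_nonneg _
  have hs : 0 < 1 + M * znorm f x u / 2 := by positivity
  have hsymm : ∀ y, (hess f y).IsSymm := fun y => (hpos y).isSymm
  refine abs_le_of_sq_le_sq' ?_
    (mul_nonneg (mul_nonneg hs.le hρ0.le) (lamG_nonneg x)) |>.2
  have h1 := quadForm_inv_le_mul hs hJ (hpos (x + u))
    (h.avgHess_comparison_right hf hsymm x u).1 (grad f (x + u))
  have h2 := quadForm_inv_le_mul hs (hpos x) hJ
    (h.avgHess_comparison_left hf hsymm x u).2 (grad f x)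
  have h3 := quadForm_inv_sub_mulVec_le hρ0 hρ1 hJ hG.isSymm hlow hup u
  have hGu : G *ᵥ u = -grad f x := by rw [hu, mulVec_neg, mulVec_inv_mulVec hG]
  rw [← grad_newton hf hsymm hG hu, hGu, mulVec_neg, neg_dotProduct_neg] at h3
  rw [← lamG_sq (hpos _)] at h1 h2
  rw [mul_pow, mul_pow]
  set s := 1 + M * znorm f x u / 2
  calc lamG f (x + u) ^ 2 ≤ _ := h1
    _ ≤ s * (ρ ^ 2 * (s * lamG f x ^ 2)) := by gcongr; exact h3.trans (by gcongr)
    _ = _ := by ring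

/-- One step of the locally linear convergence phase. -/
lemma StrongSelfConcordant.linear_step {μ L a T : ℝ} (hf : ContDiff ℝ 2 f) (hμ : 0 < μ)
    (hμL : μ ≤ L) (hM : 0 ≤ M)
    (hlow : ∀ y, (hess f y - μ • (1 : Matrix (Fin n) (Fin n) ℝ)).PosSemidef)
    (h : StrongSelfConcordant f M)
    (hGlow : (G - μ • (1 : Matrix (Fin n) (Fin n) ℝ)).PosSemidef)
    (hGup : (T • (1 : Matrix (Fin n) (Fin n) ℝ) - G).PosSemidef) (hT : T ≤ 4 / 3 * L)
    (ha0 : 0 ≤ a) (ha : a ≤ 11 / 80)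
    (hHG : ((1 + a / 2) • G - hess f x).PosSemidef) (hu : u = -(G⁻¹ *ᵥ grad f x))
    (hloc : L / μ * (M * lamG f x) ≤ 1 / 8) :
    M * znorm f x u ≤ 11 / 10 * (M * lamG f x) ∧
      M * lamG f (x + u) ≤ (1 - 11 / 20 / (L / μ)) * (M * lamG f x) := by
  have hpos : ∀ y, (hess f y).PosDef := fun y => posDef_of_sub_smul_one hμ (hlow y)
  have hsymm : ∀ y, (hess f y).IsSymm := fun y => (hpos y).isSymm
  have hG := posDef_of_sub_smul_one hμ hGlow
  have hJlow := smul_one_le_avgHess hf hlow hsymm x u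
  have hJ := posDef_of_sub_smul_one hμ hJlow
  have hlam : 0 ≤ M * lamG f x := mul_nonneg hM (lamG_nonneg x)
  have hr := znorm_newton_le (by positivity) (hpos x) hG hHG hu
  have hr1 : M * znorm f x u ≤ 11 / 10 * (M * lamG f x) := by
    have := mul_le_mul_of_nonneg_left hr hM
    nlinarith
  refine ⟨hr1, ?_⟩
  have hL : 0 < L := hμ.trans_le hμL
  obtain ⟨q, hq⟩ : ∃ q, q = μ / L := ⟨_, rfl⟩
  have hq0 : 0 < q := by rw [hq]; positivity
  have hq1 : q ≤ 1 := by rw [hq]; exact (div_le_one hL).2 hμL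
  have hκ : L / μ = q⁻¹ := by rw [hq, inv_div]
  have hlq : M * lamG f x ≤ q / 8 := by
    rw [hκ, inv_mul_le_iff₀ hq0] at hloc
    linarith
  have hr0 : 0 ≤ M * znorm f x u := mul_nonneg hM (Real.sqrt_nonneg _)
  have hcl : (avgHess f x u - (1 - (1 - 3 / 4 * q)) • G).PosSemidef := by
    rw [sub_sub_cancel]
    have h1 := hGup.smul (show 0 ≤ 3 / 4 * q by positivity)
    have h2 : ((μ - 3 / 4 * q * T) • (1 : Matrix (Fin n) (Fin n) ℝ)).PosSemidef := by
      refine PosSemidef.one.smul (sub_nonneg.2 ?_)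
      calc 3 / 4 * q * T ≤ 3 / 4 * q * (4 / 3 * L) := by gcongr
        _ = μ := by rw [hq]; field_simp
    have h3 := (h1.add h2).add hJlow
    convert h3 using 1
    module
  have hcu : ((1 + (1 - 3 / 4 * q)) • G - avgHess f x u).PosSemidef := by
    have h1 := h.avgHess_le_smul (u := u) hf hM hsymm hHG
    have h2 : ((1 + (1 - 3 / 4 * q) - (1 + a / 2) * (1 + M * znorm f x u / 2)) • G).PosSemidef := by
      refine hG.posSemidef.smul ?_
      nlinarith
    convert h1.add h2 using 1
    module
  have hfin := h.lamG_newton_le hf hM hpos hJ hG hu (by linarith) (by linarith) hcl hcu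
  have h4 : (1 + M * znorm f x u / 2) * (1 - 3 / 4 * q) ≤ 1 - 11 / 20 * q := by nlinarith
  calc M * lamG f (x + u) ≤ M * (_ * lamG f x) := mul_le_mul_of_nonneg_left hfin hM
    _ = ((1 + M * znorm f x u / 2) * (1 - 3 / 4 * q)) * (M * lamG f x) := by ring
    _ ≤ (1 - 11 / 20 * q) * (M * lamG f x) := mul_le_mul_of_nonneg_right h4 hlam
    _ = _ := by rw [hκ, div_inv_eq_mul]

end Convergence

section Invariant

/-- The bounds on the SR1 matrix `G`, the current error `lam` and the accumulated step length `E`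
that persist along the corrected iteration; `C` is the product of the correction factors and `a` is
`M` times the length of the last step. -/
structure CorrectedSR1Invariant {n : ℕ} (H G : Matrix (Fin n) (Fin n) ℝ)
    (μ L C E a lam : ℝ) : Prop where
  lower : (G - μ • (1 : Matrix (Fin n) (Fin n) ℝ)).PosSemidef
  hess_le : ((1 + a / 2) • G - H).PosSemidef
  prod_upper : ((C * L) • (1 : Matrix (Fin n) (Fin n) ℝ) - G).PosSemidef
  prod_nonneg : 0 ≤ C
  prod_le : C ≤ Real.exp (E - a / 2)
  sum_le : E + 2 * (L / μ) * lam ≤ 1 / 4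
  local_le : L / μ * lam ≤ 1 / 8
  step_nonneg : 0 ≤ a
  step_le : a ≤ 11 / 80
  lam_nonneg : 0 ≤ lam
  cond_pos : 0 < L / μ

variable {n : ℕ} {H G : Matrix (Fin n) (Fin n) ℝ} {μ L C E a lam : ℝ}

lemma CorrectedSR1Invariant.prod_le_exp (h : CorrectedSR1Invariant H G μ L C E a lam) :
    C ≤ Real.exp (1 / 4) := by
  refine h.prod_le.trans (Real.exp_le_exp.2 ?_)
  have := mul_nonneg h.cond_pos.le h.lam_nonneg
  linarith [h.sum_le, h.step_nonneg]

lemma exp_quarter_le : Real.exp (1 / 4) ≤ 4 / 3 := by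
  have h := Real.one_sub_le_exp_neg (1 / 4)
  rw [Real.exp_neg] at h
  have h2 := Real.exp_pos (1 / 4)
  rw [le_inv_comm₀ (by norm_num) h2] at h
  norm_num at h ⊢
  exact h

lemma CorrectedSR1Invariant.prod_mul_le (hL : 0 ≤ L)
    (h : CorrectedSR1Invariant H G μ L C E a lam) : C * L ≤ 4 / 3 * L :=
  mul_le_mul_of_nonneg_right (h.prod_le_exp.trans exp_quarter_le) hL

lemma corrected_SR1_invariant (f : (Fin n → ℝ) → ℝ) {M : ℝ}
    (hf : ContDiff ℝ 2 f) (hμ : 0 < μ) (hμL : μ ≤ L) (hM : 0 ≤ M)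
    (hlow : ∀ y : Fin n → ℝ, (hess f y - μ • (1 : Matrix (Fin n) (Fin n) ℝ)).PosSemidef)
    (hup : ∀ y : Fin n → ℝ, (L • (1 : Matrix (Fin n) (Fin n) ℝ) - hess f y).PosSemidef)
    (hssc : StrongSelfConcordant f M)
    (x : ℕ → Fin n → ℝ) (G : ℕ → Matrix (Fin n) (Fin n) ℝ) (r rm : ℕ → ℝ)
    (hG0 : G 0 = L • (1 : Matrix (Fin n) (Fin n) ℝ))
    (hrm0 : rm 0 = 0) (hrmS : ∀ k, rm (k+1) = r k)
    (hx : ∀ k, x (k+1) = x k - (G k)⁻¹ *ᵥ grad f (x k))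
    (hr : ∀ k, r k = znorm f (x k) (x (k+1) - x k))
    (hGS : ∀ k, G (k+1) =
      SR1 (Jmat f x k) (((1 + M * rm k / 2) * (1 + M * r k / 2)) • G k) (x (k+1) - x k))
    (hloc : L / μ * (M * lamG f (x 0)) ≤ 1 / 8) (k : ℕ) :
    CorrectedSR1Invariant (hess f (x k)) (G k) μ L
      (∏ i ∈ Finset.range k, ((1 + M * rm i / 2) * (1 + M * r i / 2)))
      (∑ i ∈ Finset.range k, M * r i) (M * rm k) (M * lamG f (x k)) := by
  have hL : 0 < L := hμ.trans_le hμL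
  have hsymm : ∀ y, (hess f y).IsSymm := fun y => (posDef_of_sub_smul_one hμ (hlow y)).isSymm
  have hκ : 0 < L / μ := by positivity
  have hκ1 : 1 ≤ L / μ := (one_le_div hμ).2 hμL
  induction k with
  | zero =>
    refine ⟨?_, ?_, ?_, ?_, ?_, ?_, hloc, ?_, ?_, mul_nonneg hM (lamG_nonneg _), hκ⟩
    · rw [hG0, ← sub_smul]
      exact PosSemidef.one.smul (sub_nonneg.2 hμL)
    · simpa [hrm0, hG0] using hup (x 0)
    · simpa [hG0] using PosSemidef.zero
    · simp
    · simp [hrm0]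
    · rw [Finset.sum_range_zero]; linarith
    · simp [hrm0]
    · rw [hrm0]; norm_num
  | succ k ih =>
    have hu : x (k + 1) - x k = -((G k)⁻¹ *ᵥ grad f (x k)) := by rw [hx]; abel
    obtain ⟨hstep, hrate⟩ := hssc.linear_step hf hμ hμL hM hlow ih.lower ih.prod_upper
      (ih.prod_mul_le hL.le) ih.step_nonneg ih.step_le ih.hess_le hu ih.local_le
    rw [← hr] at hstep
    rw [add_sub_cancel] at hrate
    have hr0 : 0 ≤ M * r k := mul_nonneg hM (by rw [hr]; exact Real.sqrt_nonneg _)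
    have ha0 := ih.step_nonneg
    have hl0 := ih.lam_nonneg
    have hloc' := ih.local_le
    have hJlow := smul_one_le_avgHess hf hlow hsymm (x k) (x (k + 1) - x k)
    have hcG := hssc.avgHess_le_smul (u := x (k + 1) - x k) hf hM hsymm ih.hess_le
    rw [← hr] at hcG
    have hSJ : (G (k + 1) - Jmat f x k).PosSemidef := by
      rw [hGS]; exact SR1_sub_posSemidef hcG
    have hGS' : (((1 + M * rm k / 2) * (1 + M * r k / 2)) • G k - G (k + 1)).PosSemidef := by
      rw [hGS]; exact sub_SR1_posSemidef hcG
    have hc0 : 0 ≤ (1 + M * rm k / 2) * (1 + M * r k / 2) := by positivity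
    have hexp : (1 + M * rm k / 2) * (1 + M * r k / 2) ≤
        Real.exp ((M * rm k + M * r k) / 2) := by
      rw [add_div, Real.exp_add]
      gcongr
      · linarith [Real.add_one_le_exp (M * rm k / 2)]
      · linarith [Real.add_one_le_exp (M * r k / 2)]
    have hκrate : L / μ * (M * lamG f (x (k + 1))) ≤
        L / μ * (M * lamG f (x k)) - 11 / 20 * (M * lamG f (x k)) := by
      calc _ ≤ L / μ * ((1 - 11 / 20 / (L / μ)) * (M * lamG f (x k))) :=
            mul_le_mul_of_nonneg_left hrate hκ.le
        _ = _ := by field_simp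
    refine ⟨hJlow.loewner_trans hSJ, ?_, ?_, ?_, ?_, ?_, ?_, ?_, ?_,
      mul_nonneg hM (lamG_nonneg _), hκ⟩
    · rw [hrmS]
      have h1 := (hssc.avgHess_comparison_right hf hsymm (x k) (x (k + 1) - x k)).2
      rw [add_sub_cancel, ← hr] at h1
      have h2 := hSJ.smul (show 0 ≤ 1 + M * r k / 2 by positivity)
      rw [smul_sub] at h2
      exact h1.loewner_trans h2
    · rw [Finset.prod_range_succ]
      have h1 := ih.prod_upper.smul hc0
      rw [smul_sub, smul_smul] at h1
      convert hGS'.loewner_trans h1 using 3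
      ring
    · rw [Finset.prod_range_succ]
      exact mul_nonneg ih.prod_nonneg hc0
    · rw [Finset.prod_range_succ, Finset.sum_range_succ, hrmS]
      calc _ ≤ Real.exp (∑ i ∈ Finset.range k, M * r i - M * rm k / 2) *
            Real.exp ((M * rm k + M * r k) / 2) :=
            mul_le_mul ih.prod_le hexp hc0 (Real.exp_pos _).le
        _ = _ := by rw [← Real.exp_add]; congr 1; ring
    · rw [Finset.sum_range_succ]
      linarith [ih.sum_le]
    · linarith
    · rw [hrmS]; exact hr0
    · rw [hrmS]
      nlinarith

lemma CorrectedSR1Invariant.upper (hL : 0 ≤ L)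
    (h : CorrectedSR1Invariant H G μ L C E a lam) :
    ((4 / 3 * L) • (1 : Matrix (Fin n) (Fin n) ℝ) - G).PosSemidef := by
  have h1 : ((4 / 3 * L - C * L) • (1 : Matrix (Fin n) (Fin n) ℝ)).PosSemidef :=
    PosSemidef.one.smul (sub_nonneg.2 (h.prod_mul_le hL))
  rw [sub_smul] at h1
  exact h.prod_upper.loewner_trans h1

end Invariant

/-- Theorem 4.2: explicit superlinear convergence of SR1 with correction
strategy: for `Mλ_f(x₀) ≤ ln(3/2)/(4κ)` and all `k ≥ 1`,
`λ_f(x_k) ≤ (e^{2n ln(eκ)/k} − 1)^{k/2} √(3κ) λ_f(x₀)`. -/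
theorem sr1_cs_superlinear_rate
    {n : ℕ} (f : (Fin n → ℝ) → ℝ) (μ L M : ℝ)
    (hf : ContDiff ℝ 2 f) (hμ : 0 < μ) (hμL : μ ≤ L) (hM : 0 ≤ M)
    (hlow : ∀ y : Fin n → ℝ, (hess f y - μ • (1 : Matrix (Fin n) (Fin n) ℝ)).PosSemidef)
    (hup : ∀ y : Fin n → ℝ, (L • (1 : Matrix (Fin n) (Fin n) ℝ) - hess f y).PosSemidef)
    (hssc : StrongSelfConcordant f M)
    (x : ℕ → Fin n → ℝ) (G : ℕ → Matrix (Fin n) (Fin n) ℝ) (r rm : ℕ → ℝ)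
    (hG0 : G 0 = L • (1 : Matrix (Fin n) (Fin n) ℝ))
    (hrm0 : rm 0 = 0) (hrmS : ∀ k, rm (k+1) = r k)
    (hx : ∀ k, x (k+1) = x k - (G k)⁻¹ *ᵥ grad f (x k))
    (hr : ∀ k, r k = znorm f (x k) (x (k+1) - x k))
    (hGS : ∀ k, G (k+1) =
      SR1 (Jmat f x k) (((1 + M * rm k / 2) * (1 + M * r k / 2)) • G k) (x (k+1) - x k))
    (hloc : M * lamG f (x 0) ≤ Real.log (3 / 2) / (4 * (L / μ))) :
    ∀ k : ℕ, 1 ≤ k →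
      lamG f (x k) ≤
        (Real.exp (2 * (n : ℝ) * Real.log (Real.exp 1 * (L / μ)) / (k : ℝ)) - 1) ^
            ((k : ℝ) / 2) *
          Real.sqrt (3 * (L / μ)) * lamG f (x 0) := by
  intro k hk
  rcases Nat.eq_zero_or_pos n with rfl | hn
  · have h0 : ∀ y, lamG f y = 0 := fun y => by simp [lamG]
    simp [h0]
  have hL : 0 < L := hμ.trans_le hμL
  have hpos : ∀ y, (hess f y).PosDef := fun y => posDef_of_sub_smul_one hμ (hlow y)
  have hsymm : ∀ y, (hess f y).IsSymm := fun y => (hpos y).isSymm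
  have hκ1 : 1 ≤ L / μ := (one_le_div hμ).2 hμL
  have hr0 : ∀ k, 0 ≤ r k := fun k => by rw [hr]; exact Real.sqrt_nonneg _
  have hrm : ∀ k, 0 ≤ rm k := fun k => by
    cases k with
    | zero => exact hrm0.ge
    | succ k => rw [hrmS]; exact hr0 k
  set c : ℕ → ℝ := fun k => (1 + M * rm k / 2) * (1 + M * r k / 2) with hc
  have hc1 : ∀ k, 1 ≤ c k := fun k => by
    have h1 := mul_nonneg hM (hr0 k)
    have h2 := mul_nonneg hM (hrm k)
    exact one_le_mul_of_one_le_of_one_le (by linarith) (by linarith)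
  have hloc0 : L / μ * (M * lamG f (x 0)) ≤ 1 / 8 := by
    have h1 : Real.log (3 / 2) ≤ 1 / 2 := by
      have := Real.log_le_sub_one_of_pos (show (0 : ℝ) < 3 / 2 by norm_num)
      linarith
    rw [le_div_iff₀ (by positivity)] at hloc
    linarith
  have hinv := corrected_SR1_invariant f hf hμ hμL hM hlow hup hssc x G r rm hG0 hrm0 hrmS hx hr
    hGS hloc0
  have hG : ∀ k, (G k).PosDef := fun k => posDef_of_sub_smul_one hμ (hinv k).lower
  have hu : ∀ k, x (k + 1) - x k = -((G k)⁻¹ *ᵥ grad f (x k)) := fun k => by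
    rw [hx]; abel
  have hJ : ∀ k, (Jmat f x k).PosDef := fun k =>
    posDef_of_sub_smul_one hμ (smul_one_le_avgHess hf hlow hsymm _ _)
  have hcG : ∀ k, (c k • G k - Jmat f x k).PosSemidef := fun k => by
    have := hssc.avgHess_le_smul (u := x (k + 1) - x k) hf hM hsymm (hinv k).hess_le
    rwa [← hr] at this
  set θ : ℕ → ℝ := fun k => grad f (x k) ⬝ᵥ ((G k)⁻¹ *ᵥ grad f (x k)) with hθ
  set y : ℕ → ℝ := fun k => c k * ((c k • G k).det / (G (k + 1)).det) with hy
  have hy1 : ∀ k, 1 ≤ y k := fun k => by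
    have h1 := (SR1_det_ratio (u := x (k + 1) - x k) (hJ k) (hcG k)).1
    rw [← hGS] at h1
    exact one_le_mul_of_one_le_of_one_le (hc1 k) h1
  have hstep : ∀ k, θ (k + 1) ≤ θ k * (y k - 1) := fun k => by
    have h1 := corrected_SR1_step (u := x (k + 1) - x k) (hc1 k) (hJ k) (hcG k)
    have h2 := grad_newton hf hsymm (hG k) (hu k)
    rw [add_sub_cancel] at h2
    rw [← hGS, quadForm_eq_of_newton (hG k) (hu k)] at h1
    change ((avgHess f (x k) (x (k + 1) - x k) - G k) *ᵥ (x (k + 1) - x k)) ⬝ᵥ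
      ((G (k + 1))⁻¹ *ᵥ ((avgHess f (x k) (x (k + 1) - x k) - G k) *ᵥ (x (k + 1) - x k))) ≤ _ at h1
    rwa [← h2] at h1
  have hθprod : θ k ≤ (∏ i ∈ Finset.range k, (y i - 1)) * θ 0 := by
    clear hk
    induction k with
    | zero => simp
    | succ k ih =>
      rw [Finset.prod_range_succ]
      calc θ (k + 1) ≤ θ k * (y k - 1) := hstep k
        _ ≤ _ := mul_le_mul_of_nonneg_right ih (by linarith [hy1 k])
        _ = _ := by ring
  have hyprod : (∏ i ∈ Finset.range k, y i) * (G k).det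
      = (∏ i ∈ Finset.range k, c i) ^ (n + 1) * L ^ n := by
    clear hk hθprod
    induction k with
    | zero => simp [hG0]
    | succ k ih =>
      have hdet := (hG (k + 1)).det_pos.ne'
      have e : y k * (G (k + 1)).det = c k ^ (n + 1) * (G k).det := by
        simp only [hy, det_smul, Fintype.card_fin]
        field_simp
        ring
      rw [Finset.prod_range_succ, Finset.prod_range_succ, mul_pow, mul_assoc, e]
      linear_combination c k ^ (n + 1) * ih
  have hCe : ∏ i ∈ Finset.range k, c i ≤ Real.exp (1 / 4) := (hinv k).prod_le_exp
  have hC0 : 0 ≤ ∏ i ∈ Finset.range k, c i :=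
    Finset.prod_nonneg fun i _ => zero_le_one.trans (hc1 i)
  set X : ℝ := 2 * (n : ℝ) * Real.log (Real.exp 1 * (L / μ)) with hX
  have hXexp : Real.exp X = Real.exp (2 * n) * (L / μ) ^ (2 * n) := by
    have h1 : 2 * (n : ℝ) * Real.log (L / μ) = (2 * n : ℕ) * Real.log (L / μ) := by push_cast; ring
    rw [hX, Real.log_mul (Real.exp_ne_zero 1) (by positivity), Real.log_exp, mul_add, mul_one,
      Real.exp_add, h1, Real.exp_nat_mul, Real.exp_log (by positivity)]
  have hX0 : 0 ≤ X := by
    have : 1 ≤ Real.exp 1 * (L / μ) :=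
      one_le_mul_of_one_le_of_one_le (Real.one_le_exp zero_le_one) hκ1
    have := Real.log_nonneg this
    positivity
  have hyX : ∏ i ∈ Finset.range k, y i ≤ Real.exp X := by
    have h1 : μ ^ n ≤ (G k).det := pow_le_det hμ (hinv k).lower
    have h2 : 0 ≤ ∏ i ∈ Finset.range k, y i :=
      Finset.prod_nonneg fun i _ => zero_le_one.trans (hy1 i)
    have h3 : (∏ i ∈ Finset.range k, y i) * μ ^ n ≤ Real.exp (1 / 4) ^ (n + 1) * L ^ n := by
      calc _ ≤ (∏ i ∈ Finset.range k, y i) * (G k).det := by gcongr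
        _ = _ := hyprod
        _ ≤ _ := by gcongr
    rw [← le_div_iff₀ (by positivity), mul_div_assoc, ← div_pow, ← Real.exp_nat_mul] at h3
    refine h3.trans ?_
    rw [hXexp]
    have hn1 : (1 : ℝ) ≤ n := by exact_mod_cast hn
    exact mul_le_mul (Real.exp_le_exp.2 (by push_cast; linarith))
      (pow_le_pow_right₀ hκ1 (by omega)) (by positivity) (Real.exp_pos _).le
  set B : ℝ := Real.exp (X / k) - 1 with hB
  have hB0 : 0 ≤ B := by
    have : 1 ≤ Real.exp (X / k) := Real.one_le_exp (by positivity)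
    linarith
  have hprod : ∏ i ∈ Finset.range k, (y i - 1) ≤ B ^ k := prod_sub_one_le hk hy1 hyX
  have hθ0 : θ 0 ≤ lamG f (x 0) ^ 2 := by
    have h1 := quadForm_inv_le_mul zero_lt_one (hpos (x 0)) (hG 0)
      (by rw [one_smul, hG0]; exact hup _) (grad f (x 0))
    rwa [one_mul, ← lamG_sq (hpos _)] at h1
  have hθ0' : 0 ≤ θ 0 := (hG 0).inv.posSemidef.quadForm_nonneg _
  have hlam : lamG f (x k) ^ 2 ≤ 3 * (L / μ) * θ k := by
    rw [lamG_sq (hpos _)]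
    refine quadForm_inv_le_mul (by positivity) (hG k) (hpos _) ?_ _
    have h1 := (hlow (x k)).smul (show 0 ≤ 3 * (L / μ) by positivity)
    have h2 : ((3 * (L / μ) * μ - 4 / 3 * L) • (1 : Matrix (Fin n) (Fin n) ℝ)).PosSemidef := by
      refine PosSemidef.one.smul ?_
      have : 3 * (L / μ) * μ = 3 * L := by field_simp
      linarith
    convert (h1.add h2).add ((hinv k).upper hL.le) using 1
    module
  refine abs_le_of_sq_le_sq' ?_ (mul_nonneg (mul_nonneg (Real.rpow_nonneg hB0 _)
    (Real.sqrt_nonneg _)) (lamG_nonneg _)) |>.2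
  rw [mul_pow, mul_pow, Real.sq_sqrt (by positivity), ← Real.rpow_mul_natCast hB0]
  rw [show (k : ℝ) / 2 * (2 : ℕ) = k by push_cast; ring, Real.rpow_natCast]
  calc lamG f (x k) ^ 2 ≤ 3 * (L / μ) * θ k := hlam
    _ ≤ 3 * (L / μ) * (B ^ k * lamG f (x 0) ^ 2) := by
      gcongr
      exact hθprod.trans (mul_le_mul hprod hθ0 hθ0' (by positivity))
    _ = _ := by ring
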